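/- Let Z be an asymmetric partition with representation Z'. Then the natural projection π restricted to the set A_{Z'} = {X ∈ 𝒳 : ‖X − Z'‖ ≤ α_Z/4} is a bijective isometry onto the asymmetry ball A_Z = {X ∈ 𝒫 : δ(X, Z) ≤ α_Z/4}; that is, π maps A_{Z'} bijectively onto A_Z and δ(π(X), π(Y)) = ‖X − Y‖ for all X, Y ∈ A_{Z'}. -/

import Mathlib

/-!
Partition spaces for consensus clustering (Jain, "Condorcet's Jury Theorem for
Consensus Clustering").  Labeled partitions are ℓ×m column-stochastic matrices
with entries in [0,1]; the group Π of ℓ×ℓ permutation matrices acts by left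
multiplication; partitions are orbits; δ is induced by the Frobenius norm.
-/

namespace CJT

/-- ℓ×m real matrices. -/
abbrev Mat (l m : ℕ) := Matrix (Fin l) (Fin m) ℝ

/-- `P` is an ℓ×ℓ permutation matrix. -/
def IsPermMatrix {l : ℕ} (P : Matrix (Fin l) (Fin l) ℝ) : Prop :=
  ∃ σ : Equiv.Perm (Fin l), ∀ i k, P i k = if σ i = k then 1 else 0

/-- `X` is a labeled partition: entries in `[0,1]`, columns summing to one. -/
def IsLabeled {l m : ℕ} (X : Mat l m) : Prop :=
  (∀ i j, 0 ≤ X i j ∧ X i j ≤ 1) ∧ ∀ j, (∑ i, X i j) = 1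

/-- The orbit `[X] = {P X : P ∈ Π}` of a labeled partition. -/
def orbit {l m : ℕ} (X : Mat l m) : Set (Mat l m) :=
  {Y | ∃ P : Matrix (Fin l) (Fin l) ℝ, IsPermMatrix P ∧ Y = P * X}

/-- The partition space 𝒫: all orbits of labeled partitions. -/
def PartitionSpace (l m : ℕ) : Set (Set (Mat l m)) :=
  {A | ∃ X : Mat l m, IsLabeled X ∧ A = orbit X}

/-- Frobenius (Euclidean) norm. -/
noncomputable def frobNorm {l m : ℕ} (X : Mat l m) : ℝ :=
  Real.sqrt (∑ i, ∑ j, (X i j) ^ 2)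

/-- `δ(A, B) = min {‖X' − Y'‖ : X' ∈ A, Y' ∈ B}`. -/
noncomputable def pdist {l m : ℕ} (A B : Set (Mat l m)) : ℝ :=
  sInf {d | ∃ X ∈ A, ∃ Y ∈ B, d = frobNorm (X - Y)}

/-- The degree of asymmetry
`α_Z = min {‖Z' − P Z'‖ : Z' ∈ Z, P ∈ Π, P ≠ I}` of a partition `Z`. -/
noncomputable def asym {l m : ℕ} (A : Set (Mat l m)) : ℝ :=
  sInf {d | ∃ Z' ∈ A, ∃ P : Matrix (Fin l) (Fin l) ℝ,
    IsPermMatrix P ∧ P ≠ 1 ∧ d = frobNorm (Z' - P * Z')}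

open scoped Matrix.Norms.Frobenius in
theorem frobNorm_eq_norm {l m : ℕ} (X : Mat l m) : frobNorm X = ‖X‖ := by
  simp [frobNorm, Matrix.frobenius_norm_def, Real.sqrt_eq_rpow]

theorem frobNorm_nonneg {l m : ℕ} (X : Mat l m) : 0 ≤ frobNorm X :=
  Real.sqrt_nonneg _

open scoped Matrix.Norms.Frobenius in
theorem frobNorm_sub_comm {l m : ℕ} (X Y : Mat l m) :
    frobNorm (X - Y) = frobNorm (Y - X) := by
  simp only [frobNorm_eq_norm, norm_sub_rev]

open scoped Matrix.Norms.Frobenius in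
theorem frobNorm_sub_le {l m : ℕ} (X Y W : Mat l m) :
    frobNorm (X - W) ≤ frobNorm (X - Y) + frobNorm (Y - W) := by
  simpa only [frobNorm_eq_norm] using norm_sub_le_norm_sub_add_norm_sub X Y W

open scoped Matrix.Norms.Frobenius in
theorem eq_of_frobNorm_sub_eq_zero {l m : ℕ} {X Y : Mat l m} (h : frobNorm (X - Y) = 0) :
    X = Y := by
  rwa [frobNorm_eq_norm, norm_eq_zero, sub_eq_zero] at h

theorem frobNorm_submatrix {l m : ℕ} (X : Mat l m) (σ : Equiv.Perm (Fin l)) :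
    frobNorm (X.submatrix σ id) = frobNorm X := by
  unfold frobNorm
  congr 1
  exact Equiv.sum_comp σ fun i => ∑ j, X i j ^ 2

theorem frobNorm_submatrix_sub {l m : ℕ} (X Y : Mat l m) (σ : Equiv.Perm (Fin l)) :
    frobNorm (X.submatrix σ id - Y.submatrix σ id) = frobNorm (X - Y) :=
  frobNorm_submatrix (X - Y) σ

/-- Left multiplication by a permutation matrix permutes the rows. -/
theorem perm_mul_eq_submatrix {l m : ℕ} {P : Matrix (Fin l) (Fin l) ℝ}
    {σ : Equiv.Perm (Fin l)} (hP : ∀ i k, P i k = if σ i = k then 1 else 0) (X : Mat l m) :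
    P * X = X.submatrix σ id := by
  ext i j
  simp [Matrix.mul_apply, hP]

theorem mem_orbit_iff {l m : ℕ} {X Y : Mat l m} :
    Y ∈ orbit X ↔ ∃ σ : Equiv.Perm (Fin l), Y = X.submatrix σ id := by
  constructor
  · rintro ⟨P, ⟨σ, hP⟩, rfl⟩
    exact ⟨σ, perm_mul_eq_submatrix hP X⟩
  · rintro ⟨σ, rfl⟩
    exact ⟨Matrix.of fun i k => if σ i = k then 1 else 0, ⟨σ, fun _ _ => rfl⟩,
      (perm_mul_eq_submatrix (fun _ _ => rfl) X).symm⟩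

theorem submatrix_mem_orbit {l m : ℕ} (X : Mat l m) (σ : Equiv.Perm (Fin l)) :
    X.submatrix σ id ∈ orbit X :=
  mem_orbit_iff.2 ⟨σ, rfl⟩

theorem self_mem_orbit {l m : ℕ} (X : Mat l m) : X ∈ orbit X :=
  submatrix_mem_orbit X 1

theorem orbit_submatrix {l m : ℕ} (X : Mat l m) (σ : Equiv.Perm (Fin l)) :
    orbit (X.submatrix σ id) = orbit X := by
  ext Y
  simp only [mem_orbit_iff]
  constructor
  · rintro ⟨τ, rfl⟩
    exact ⟨σ * τ, rfl⟩
  · rintro ⟨τ, rfl⟩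
    exact ⟨σ⁻¹ * τ, by ext i j; simp⟩

theorem orbit_eq_of_mem {l m : ℕ} {X Y : Mat l m} (h : Y ∈ orbit X) : orbit Y = orbit X := by
  obtain ⟨σ, rfl⟩ := mem_orbit_iff.1 h
  exact orbit_submatrix X σ

theorem IsLabeled.submatrix {l m : ℕ} {X : Mat l m} (hX : IsLabeled X)
    (σ : Equiv.Perm (Fin l)) : IsLabeled (X.submatrix σ id) :=
  ⟨fun i j => hX.1 (σ i) j, fun j => (Equiv.sum_comp σ fun i => X i j).trans (hX.2 j)⟩

theorem orbit_finite {l m : ℕ} (X : Mat l m) : (orbit X).Finite :=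
  (Set.finite_range fun σ : Equiv.Perm (Fin l) => X.submatrix σ id).subset fun _ hY =>
    let ⟨σ, hσ⟩ := mem_orbit_iff.1 hY
    ⟨σ, hσ.symm⟩

theorem pdist_le {l m : ℕ} {A B : Set (Mat l m)} {X Y : Mat l m} (hX : X ∈ A) (hY : Y ∈ B) :
    pdist A B ≤ frobNorm (X - Y) :=
  csInf_le ⟨0, by rintro _ ⟨_, _, _, _, rfl⟩; exact frobNorm_nonneg _⟩ ⟨X, hX, Y, hY, rfl⟩

/-- The minimum defining the distance of two orbits is attained. -/
theorem exists_pdist_orbit_eq {l m : ℕ} (X Y : Mat l m) :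
    ∃ X' ∈ orbit X, ∃ Y' ∈ orbit Y, pdist (orbit X) (orbit Y) = frobNorm (X' - Y') := by
  refine Set.Nonempty.csInf_mem (s := {d | ∃ X' ∈ orbit X, ∃ Y' ∈ orbit Y,
    d = frobNorm (X' - Y')}) ⟨_, X, self_mem_orbit X, Y, self_mem_orbit Y, rfl⟩ ?_
  refine (((orbit_finite X).prod (orbit_finite Y)).image fun p => frobNorm (p.1 - p.2)).subset ?_
  rintro _ ⟨X', hX', Y', hY', rfl⟩
  exact ⟨(X', Y'), ⟨hX', hY'⟩, rfl⟩

/-- One of the two representations in the distance of two orbits can be fixed. -/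
theorem exists_pdist_orbit_eq_right {l m : ℕ} (X Y : Mat l m) :
    ∃ σ : Equiv.Perm (Fin l),
      pdist (orbit X) (orbit Y) = frobNorm (X.submatrix σ id - Y) := by
  obtain ⟨X', hX', Y', hY', h⟩ := exists_pdist_orbit_eq X Y
  obtain ⟨σ, rfl⟩ := mem_orbit_iff.1 hX'
  obtain ⟨τ, rfl⟩ := mem_orbit_iff.1 hY'
  refine ⟨σ * τ⁻¹, ?_⟩
  rw [h, ← frobNorm_submatrix_sub _ _ τ⁻¹]
  congr 2
  ext i j
  simp

theorem asym_le {l m : ℕ} {A : Set (Mat l m)} {W : Mat l m} (hW : W ∈ A)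
    {σ : Equiv.Perm (Fin l)} (hσ : σ ≠ 1) : asym A ≤ frobNorm (W - W.submatrix σ id) := by
  refine csInf_le ⟨0, by rintro _ ⟨_, _, _, _, _, rfl⟩; exact frobNorm_nonneg _⟩
    ⟨W, hW, Matrix.of fun i k => if σ i = k then 1 else 0, ⟨σ, fun _ _ => rfl⟩, ?_, ?_⟩
  · intro h
    refine hσ (Equiv.ext fun i => ?_)
    by_contra hne
    have hi := congrFun (congrFun h i) i
    simp_all
  · exact congrArg (fun V => frobNorm (W - V)) (perm_mul_eq_submatrix (fun _ _ => rfl) W).symm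

/-- Within the ball of radius `asym A / 4` around a representation, the orbit distance is the
Frobenius distance. -/
theorem pdist_orbit_eq_frobNorm {l m : ℕ} {A : Set (Mat l m)} {W X Y : Mat l m} (hW : W ∈ A)
    (hX : frobNorm (X - W) ≤ asym A / 4) (hY : frobNorm (Y - W) ≤ asym A / 4) :
    pdist (orbit X) (orbit Y) = frobNorm (X - Y) := by
  refine le_antisymm (pdist_le (self_mem_orbit X) (self_mem_orbit Y)) ?_
  obtain ⟨σ, h⟩ := exists_pdist_orbit_eq_right X Y
  rw [h]
  rcases eq_or_ne σ 1 with rfl | hσ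
  · exact le_rfl
  have hasym := asym_le hW hσ
  have hXY := frobNorm_sub_le X W Y
  have hWY := frobNorm_sub_le W Y (W.submatrix σ id)
  have hYX := frobNorm_sub_le Y (X.submatrix σ id) (W.submatrix σ id)
  rw [frobNorm_submatrix_sub] at hYX
  rw [frobNorm_sub_comm Y (X.submatrix σ id)] at hYX
  rw [frobNorm_sub_comm W Y] at hXY hWY
  linarith

/-- Let `Z` be an asymmetric partition with representation
`Z'`.  Then the natural projection `π` restricted to
`A_{Z'} = {X ∈ 𝒳 : ‖X − Z'‖ ≤ α_Z/4}` is a bijective isometry onto the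
asymmetry ball `A_Z = {X ∈ 𝒫 : δ(X, Z) ≤ α_Z/4}`: it maps `A_{Z'}` bijectively
onto `A_Z` and satisfies `δ(π(X), π(Y)) = ‖X − Y‖` for all `X, Y ∈ A_{Z'}`. -/
theorem projection_isometry_on_asymmetry_ball (l m : ℕ) (hl : 1 ≤ l) (hm : 1 ≤ m)
    (Z : Set (Mat l m)) (hZ : Z ∈ PartitionSpace l m) (hasym : 0 < asym Z)
    (Z' : Mat l m) (hZ' : Z' ∈ Z) :
    -- π maps A_{Z'} into A_Z
    (∀ X : Mat l m, IsLabeled X → frobNorm (X - Z') ≤ asym Z / 4 →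
      orbit X ∈ PartitionSpace l m ∧ pdist (orbit X) Z ≤ asym Z / 4) ∧
    -- injectivity on A_{Z'}
    (∀ X Y : Mat l m, IsLabeled X → frobNorm (X - Z') ≤ asym Z / 4 →
      IsLabeled Y → frobNorm (Y - Z') ≤ asym Z / 4 →
      orbit X = orbit Y → X = Y) ∧
    -- surjectivity onto A_Z
    (∀ A : Set (Mat l m), A ∈ PartitionSpace l m → pdist A Z ≤ asym Z / 4 →
      ∃ X : Mat l m, IsLabeled X ∧ frobNorm (X - Z') ≤ asym Z / 4 ∧ orbit X = A) ∧
    -- isometry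
    (∀ X Y : Mat l m, IsLabeled X → frobNorm (X - Z') ≤ asym Z / 4 →
      IsLabeled Y → frobNorm (Y - Z') ≤ asym Z / 4 →
      pdist (orbit X) (orbit Y) = frobNorm (X - Y)) := by
  obtain ⟨Z₀, -, rfl⟩ := hZ
  refine ⟨fun X hX hXZ => ⟨⟨X, hX, rfl⟩, (pdist_le (self_mem_orbit X) hZ').trans hXZ⟩,
    fun X Y _ hXZ _ hYZ h => ?_, ?_, fun X Y _ hXZ _ hYZ => pdist_orbit_eq_frobNorm hZ' hXZ hYZ⟩
  · apply eq_of_frobNorm_sub_eq_zero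
    rw [← pdist_orbit_eq_frobNorm hZ' hXZ hYZ, h, pdist_orbit_eq_frobNorm hZ' hYZ hYZ]
    simp [frobNorm]
  · rintro _ ⟨X, hX, rfl⟩ h
    obtain ⟨σ, hσ⟩ := exists_pdist_orbit_eq_right X Z'
    rw [orbit_eq_of_mem hZ'] at hσ
    exact ⟨X.submatrix σ id, hX.submatrix σ, hσ ▸ h, orbit_submatrix X σ⟩

end CJT
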